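/- Let S be a stably compact formal topology and let ◁^D be the cover of its de Groot dual S^D. Then for all finite A ⊆ S and all 𝒰 ⊆ Fin(S): A ◁^D 𝒰 if and only if for every finite B with A ≪ B there exists a finite 𝒰₀ ⊆ 𝒰 such that ↟B ⊆ ⋁^F_{C ∈ 𝒰₀} ↟C. Consequently, the de Groot dual S^D is a stably compact formal topology. -/

import Mathlib

noncomputable section
open Classical

universe u v

namespace FTP

/-! ### Basic covers -/

/-- `U ◁ V` : every element of `U` is covered by `V`. -/
def covS {S : Type*} (cov : S → Set S → Prop) (U V : Set S) : Prop :=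
  ∀ a ∈ U, cov a V

/-- A basic cover: reflexivity and transitivity. -/
def IsBasicCover {S : Type*} (cov : S → Set S → Prop) : Prop :=
  (∀ (a : S) (U : Set S), a ∈ U → cov a U) ∧
  (∀ (a : S) (U V : Set S), cov a U → covS cov U V → cov a V)

/-- the way-below relation `a ≪ b`. -/
def wb {S : Type*} (cov : S → Set S → Prop) (a b : S) : Prop :=
  ∀ U : Set S, cov b U → ∃ U₀ : Finset S, ↑U₀ ⊆ U ∧ cov a ↑U₀

/-- the way-below relation between subsets `U ≪ V`. -/
def wbS {S : Type*} (cov : S → Set S → Prop) (U V : Set S) : Prop :=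
  ∀ W : Set S, covS cov V W → ∃ W₀ : Finset S, ↑W₀ ⊆ W ∧ covS cov U ↑W₀

/-- A continuous basic cover, with the witnessing function `w`. -/
def IsContinuous {S : Type*} (cov : S → Set S → Prop) (w : S → Set S) : Prop :=
  (∀ a : S, ∀ b ∈ w a, wb cov b a) ∧ (∀ a : S, cov a (w a))

/-- splitting subsets. -/
def Splitting {S : Type*} (cov : S → Set S → Prop) (V : Set S) : Prop :=
  ∀ (a : S) (U : Set S), a ∈ V → cov a U → (V ∩ U).Nonempty

/-- located subsets. -/
def Located {S : Type*} (cov : S → Set S → Prop) (V : Set S) : Prop :=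
  Splitting cov V ∧ ∀ a b : S, wb cov a b → a ∉ V ∨ b ∈ V

/-- inverse image of a relation. -/
def rinv {α β : Type*} (r : α → β → Prop) (U : Set β) : Set α :=
  {x | ∃ a ∈ U, r x a}

/-- basic cover maps. -/
def IsBCM {α β : Type*} (cov : α → Set α → Prop) (cov' : β → Set β → Prop)
    (r : α → β → Prop) : Prop :=
  ∀ (a : β) (U : Set β), cov' a U → covS cov (rinv r {a}) (rinv r U)

/-- perfect maps. -/
def IsPerfect {α β : Type*} (cov : α → Set α → Prop) (cov' : β → Set β → Prop)
    (r : α → β → Prop) : Prop :=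
  ∀ a b : β, wb cov' a b → wbS cov (rinv r {a}) (rinv r {b})

/-- the terminal basic cover `1 = ({∗}, ∈)`. -/
def unitCov : Unit → Set Unit → Prop := fun x U => x ∈ U

/-! ### Formal topologies -/

/-- `U ↓ V` with respect to a preorder `le`. -/
def down {S : Type*} (le : S → S → Prop) (U V : Set S) : Set S :=
  {c | ∃ a ∈ U, ∃ b ∈ V, le c a ∧ le c b}

/-- A formal topology: a basic cover together with a compatible preorder. -/
def IsFormalTopology {S : Type*} (cov : S → Set S → Prop) (le : S → S → Prop) : Prop :=
  IsBasicCover cov ∧ Reflexive le ∧ Transitive le ∧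
  (∀ a b : S, le a b → cov a {b}) ∧
  (∀ (a : S) (U V : Set S), cov a U → cov a V → cov a (down le U V))

/-- formal topology maps. -/
def IsFTM {α β : Type*} (cov : α → Set α → Prop) (le : α → α → Prop)
    (cov' : β → Set β → Prop) (le' : β → β → Prop) (r : α → β → Prop) : Prop :=
  IsBCM cov cov' r ∧
  covS cov Set.univ (rinv r Set.univ) ∧
  ∀ a b : β, covS cov (down le (rinv r {a}) (rinv r {b})) (rinv r (down le' {a} {b}))

/-- the order on maps. -/
def MapLE {α β : Type*} (cov : α → Set α → Prop) (r s : α → β → Prop) : Prop :=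
  ∀ a : β, covS cov (rinv r {a}) (rinv s {a})

/-- equality of maps. -/
def MapEq {α β : Type*} (cov : α → Set α → Prop) (r s : α → β → Prop) : Prop :=
  MapLE cov r s ∧ MapLE cov s r

/-- composition of relational maps (`comp s r = s ∘ r`). -/
def comp {α β γ : Type*} (s : β → γ → Prop) (r : α → β → Prop) : α → γ → Prop :=
  fun x c => ∃ b, r x b ∧ s b c

/-- `b* = {c | c ↓ b ◁ ∅}`. -/
def star {S : Type*} (cov : S → Set S → Prop) (le : S → S → Prop) (b : S) : Set S :=
  {c | covS cov (down le {c} {b}) ∅}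

/-- `b ⋘ a` iff `S ◁ b* ∪ {a}`. -/
def wc {S : Type*} (cov : S → Set S → Prop) (le : S → S → Prop) (b a : S) : Prop :=
  covS cov Set.univ (star cov le b ∪ {a})

/-- regular formal topologies. -/
def Regular {S : Type*} (cov : S → Set S → Prop) (le : S → S → Prop) : Prop :=
  ∀ a : S, cov a {b | wc cov le b a}

/-- compactness: `S ≪ S`. -/
def Compact {S : Type*} (cov : S → Set S → Prop) : Prop :=
  wbS cov Set.univ Set.univ

/-- stability: `a ≪ a'` and `b ≪ b'` imply `a↓b ≪ a'↓b'`. -/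
def Stable {S : Type*} (cov : S → Set S → Prop) (le : S → S → Prop) : Prop :=
  ∀ a a' b b' : S, wb cov a a' → wb cov b b' →
    wbS cov (down le {a} {b}) (down le {a'} {b'})

/-- isomorphism of formal topologies. -/
def IsIso {α β : Type*} (cov : α → Set α → Prop) (le : α → α → Prop)
    (cov' : β → Set β → Prop) (le' : β → β → Prop) : Prop :=
  ∃ (r : α → β → Prop) (s : β → α → Prop),
    IsFTM cov le cov' le' r ∧ IsFTM cov' le' cov le s ∧
    MapEq cov (comp s r) (fun a b => a = b) ∧
    MapEq cov' (comp r s) (fun a b => a = b)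

/-! ### Geometric theories and the covers they present -/

/-- the preorder `A ≤ B ↔ B ⊆ A` on finite sets of generators. -/
def supord {P : Type*} : Finset P → Finset P → Prop := fun A B => B ⊆ A

/-- The cover on `Finset P` inductively generated by a geometric theory `T`
(an axiom `T A 𝒞` means `⋀A ⊢ ⋁_{B ∈ 𝒞} ⋀B`). -/
inductive GCov {P : Type*} (T : Finset P → Set (Finset P) → Prop) :
    Finset P → Set (Finset P) → Prop where
  | refl {A : Finset P} {𝒰 : Set (Finset P)} : A ∈ 𝒰 → GCov T A 𝒰
  | le {A B : Finset P} {𝒰 : Set (Finset P)} : B ⊆ A → GCov T B 𝒰 → GCov T A 𝒰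
  | ax {A : Finset P} {𝒞 𝒰 : Set (Finset P)} (C : Finset P) :
      T A 𝒞 → (∀ B ∈ 𝒞, GCov T (C ∪ B) 𝒰) → GCov T (C ∪ A) 𝒰

theorem GCov_trans {P : Type*} {T : Finset P → Set (Finset P) → Prop}
    {A : Finset P} {𝒰 𝒱 : Set (Finset P)}
    (h : GCov T A 𝒰) (h' : ∀ B ∈ 𝒰, GCov T B 𝒱) : GCov T A 𝒱 := by
  induction h with
  | refl hA => exact h' _ hA
  | le hBA _ ih => exact GCov.le hBA (ih h')
  | ax C hT _ ih => exact GCov.ax C hT (fun B hB => ih B hB h')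

theorem GCov_isBasicCover {P : Type*} (T : Finset P → Set (Finset P) → Prop) :
    IsBasicCover (GCov T) :=
  ⟨fun _ _ h => GCov.refl h, fun _ _ _ h h' => GCov_trans h h'⟩

/-! ### The patch, Lawson and lower powerlocale theories -/

/-- generators of the patch/Lawson theories : `r a` and `l A`. -/
inductive PatchGen (S : Type u) : Type u where
  | r : S → PatchGen S
  | l : Finset S → PatchGen S

/-- The geometric theory `T_P` presenting the patch of a stably locally compact
formal topology. -/
inductive PatchThy {S : Type*} (cov : S → Set S → Prop) (le : S → S → Prop) :
    Finset (PatchGen S) → Set (Finset (PatchGen S)) → Prop where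
  | R1 : PatchThy cov le ∅ {B | ∃ a : S, B = {PatchGen.r a}}
  | R2 (a b : S) :
      PatchThy cov le {PatchGen.r a, PatchGen.r b}
        {B | ∃ c ∈ down le {a} {b}, B = {PatchGen.r c}}
  | R3 (a : S) (A : Finset S) :
      cov a ↑A → PatchThy cov le {PatchGen.r a} {B | ∃ b ∈ A, B = {PatchGen.r b}}
  | R4 (a : S) :
      PatchThy cov le {PatchGen.r a} {B | ∃ b : S, wb cov b a ∧ B = {PatchGen.r b}}
  | L1 : PatchThy cov le ∅ {({PatchGen.l ∅} : Finset (PatchGen S))}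
  | L2 (A B : Finset S) :
      covS cov ↑A ↑B →
      PatchThy cov le {PatchGen.l B} {({PatchGen.l A} : Finset (PatchGen S))}
  | L3 (A B : Finset S) :
      PatchThy cov le {PatchGen.l A, PatchGen.l B}
        {D | ∃ C : Finset S, wbS cov ↑A ↑C ∧ wbS cov ↑B ↑C ∧ D = {PatchGen.l C}}
  | Loc (a b : S) :
      wb cov a b →
      PatchThy cov le ∅
        {({PatchGen.l {a}} : Finset (PatchGen S)), ({PatchGen.r b} : Finset (PatchGen S))}
  | D (a : S) :
      PatchThy cov le {PatchGen.l {a}, PatchGen.r a} (∅ : Set (Finset (PatchGen S)))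

/-- the cover of `Patch(S)`. -/
def patchCov {S : Type*} (cov : S → Set S → Prop) (le : S → S → Prop) :
    Finset (PatchGen S) → Set (Finset (PatchGen S)) → Prop :=
  GCov (PatchThy cov le)

/-- the counit `ε_P : Patch(S) → S`. -/
def epsP {S : Type*} (cov : S → Set S → Prop) (le : S → S → Prop) :
    Finset (PatchGen S) → S → Prop :=
  fun 𝔄 a => patchCov cov le 𝔄 {({PatchGen.r a} : Finset (PatchGen S))}

/-- The geometric theory `T_L` presenting the Lawson topology of a continuous
basic cover (the axioms of `T_P` without (R1), (R2)). -/
inductive LawsonThy {S : Type*} (cov : S → Set S → Prop) :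
    Finset (PatchGen S) → Set (Finset (PatchGen S)) → Prop where
  | R3 (a : S) (A : Finset S) :
      cov a ↑A → LawsonThy cov {PatchGen.r a} {B | ∃ b ∈ A, B = {PatchGen.r b}}
  | R4 (a : S) :
      LawsonThy cov {PatchGen.r a} {B | ∃ b : S, wb cov b a ∧ B = {PatchGen.r b}}
  | L1 : LawsonThy cov ∅ {({PatchGen.l ∅} : Finset (PatchGen S))}
  | L2 (A B : Finset S) :
      covS cov ↑A ↑B →
      LawsonThy cov {PatchGen.l B} {({PatchGen.l A} : Finset (PatchGen S))}
  | L3 (A B : Finset S) :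
      LawsonThy cov {PatchGen.l A, PatchGen.l B}
        {D | ∃ C : Finset S, wbS cov ↑A ↑C ∧ wbS cov ↑B ↑C ∧ D = {PatchGen.l C}}
  | Loc (a b : S) :
      wb cov a b →
      LawsonThy cov ∅
        {({PatchGen.l {a}} : Finset (PatchGen S)), ({PatchGen.r b} : Finset (PatchGen S))}
  | D (a : S) :
      LawsonThy cov {PatchGen.l {a}, PatchGen.r a} (∅ : Set (Finset (PatchGen S)))

/-- the cover of the Lawson topology `L(S)`. -/
def lawsonCov {S : Type*} (cov : S → Set S → Prop) :
    Finset (PatchGen S) → Set (Finset (PatchGen S)) → Prop :=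
  GCov (LawsonThy cov)

/-- the counit `ε_L : L(S) → S`. -/
def epsL {S : Type*} (cov : S → Set S → Prop) : Finset (PatchGen S) → S → Prop :=
  fun 𝔄 a => lawsonCov cov 𝔄 {({PatchGen.r a} : Finset (PatchGen S))}

/-- The theory presenting the lower powerlocale of a continuous basic cover:
generators `a ∈ S`, axioms (R3) and (R4). -/
inductive LowerThy {S : Type*} (cov : S → Set S → Prop) :
    Finset S → Set (Finset S) → Prop where
  | R3 (a : S) (A : Finset S) :
      cov a ↑A → LowerThy cov {a} {B | ∃ b ∈ A, B = ({b} : Finset S)}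
  | R4 (a : S) :
      LowerThy cov {a} {B | ∃ b : S, wb cov b a ∧ B = ({b} : Finset S)}

/-- the cover of the lower powerlocale `Lower(S)`. -/
def lowerCov {S : Type*} (cov : S → Set S → Prop) :
    Finset S → Set (Finset S) → Prop :=
  GCov (LowerThy cov)

/-- the counit `σ_L : Lower(S) → S`. -/
def sigmaL {S : Type*} (cov : S → Set S → Prop) : Finset S → S → Prop :=
  fun A a => lowerCov cov A ({({a} : Finset S)} : Set (Finset S))

/-! ### de Groot duals -/

/-- `↟A = {B ∈ Fin S | A ≪ B}`. -/
def upF {S : Type*} (cov : S → Set S → Prop) (A : Finset S) : Set (Finset S) :=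
  {B | wbS cov ↑A ↑B}

/-- the finite join `⋁^F {↟A | A ∈ 𝒜}` of Scott open filters. -/
def finJoin {S : Type*} (cov : S → Set S → Prop) (le : S → S → Prop)
    (𝒜 : Finset (Finset S)) : Set (Finset S) :=
  if 𝒜 = ∅ then {B | covS cov Set.univ ↑B}
  else {B | ∃ g : Finset S → Finset S,
    (∀ A ∈ 𝒜, wbS cov ↑A ↑(g A)) ∧
    wbS cov {c | ∀ A ∈ 𝒜, ∃ b ∈ g A, le c b} ↑B}

/-- The cover `◁^D` of the de Groot dual `S^D`, inductively generated on
`(Fin S, ⊇)` by the axioms (D3) `A ◁ ↟A` and (D4). -/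
inductive DCov {S : Type*} (cov : S → Set S → Prop) (le : S → S → Prop) :
    Finset S → Set (Finset S) → Prop where
  | refl {A : Finset S} {𝒰 : Set (Finset S)} : A ∈ 𝒰 → DCov cov le A 𝒰
  | le {A B : Finset S} {𝒰 : Set (Finset S)} :
      B ⊆ A → DCov cov le B 𝒰 → DCov cov le A 𝒰
  | d3 {A A' : Finset S} {𝒰 : Set (Finset S)} :
      A ⊆ A' →
      (∀ C : Finset S, A' ⊆ C → (∃ B : Finset S, wbS cov ↑A ↑B ∧ B ⊆ C) →
        DCov cov le C 𝒰) →
      DCov cov le A' 𝒰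
  | d4 {A A' : Finset S} {𝒜 : Finset (Finset S)} {𝒰 : Set (Finset S)} :
      A ⊆ A' → upF cov A ⊆ finJoin cov le 𝒜 →
      (∀ C : Finset S, A' ⊆ C → (∃ B ∈ 𝒜, B ⊆ C) → DCov cov le C 𝒰) →
      DCov cov le A' 𝒰

/-- the cover of the Scott topology `Σ(S)` on `(Fin S, ⊇)`. -/
def scottCov {S : Type*} (cov : S → Set S → Prop) :
    Finset S → Set (Finset S) → Prop :=
  fun A 𝒰 => upF cov A ⊆ ⋃ B ∈ 𝒰, upF cov B

/-- a filter (with respect to `◁`) of basic opens, given by a set of finite subsets. -/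
def IsCovFilter {S : Type*} (cov : S → Set S → Prop) (le : S → S → Prop)
    (𝒱 : Set (Finset S)) : Prop :=
  𝒱.Nonempty ∧
  (∀ A ∈ 𝒱, ∀ B : Finset S, covS cov ↑A ↑B → B ∈ 𝒱) ∧
  (∀ A ∈ 𝒱, ∀ B ∈ 𝒱, ∃ C ∈ 𝒱, covS cov ↑C (down le ↑A ↑B))

/-- The geometric theory `T^d` presenting the de Groot dual `S^d`:
generators `l A` (identified with `A : Finset S`), axioms (L1)–(L3) and (D4). -/
inductive DGThy {S : Type*} (cov : S → Set S → Prop) (le : S → S → Prop) :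
    Finset (Finset S) → Set (Finset (Finset S)) → Prop where
  | L1 : DGThy cov le ∅ {({(∅ : Finset S)} : Finset (Finset S))}
  | L2 (A B : Finset S) :
      covS cov ↑A ↑B → DGThy cov le {B} {({A} : Finset (Finset S))}
  | L3 (A B : Finset S) :
      DGThy cov le {A, B}
        {D | ∃ C : Finset S, wbS cov ↑A ↑C ∧ wbS cov ↑B ↑C ∧ D = ({C} : Finset (Finset S))}
  | D4 (A : Finset S) (𝒜 : Finset (Finset S)) :
      upF cov A ⊆ finJoin cov le 𝒜 →
      DGThy cov le {A} {D | ∃ B ∈ 𝒜, D = ({B} : Finset (Finset S))}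

/-! ### Spectral formal topologies -/

/-- spectral formal topologies: a compatible meet-semilattice structure on the
base, with every basic element way-below itself. -/
def IsSpectral {S : Type*} (cov : S → Set S → Prop) (le : S → S → Prop)
    (one : S) (meet : S → S → S) : Prop :=
  (∀ a : S, cov a {one}) ∧
  (∀ a b : S, cov (meet a b) (down le {a} {b})) ∧
  (∀ a b : S, ∀ c ∈ down le {a} {b}, cov c {meet a b}) ∧
  (∀ a : S, wb cov a a)

/-! ### Subtopologies -/

/-- the property of being a formal-topology cover compatible with `le`. -/
def IsFTCover {S : Type*} (cov : S → Set S → Prop) (le : S → S → Prop) : Prop :=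
  IsBasicCover cov ∧ (∀ a b : S, le a b → cov a {b}) ∧
  (∀ (a : S) (U V : Set S), cov a U → cov a V → cov a (down le U V))

/-- The meet (in `SubTop(S)`) of a family of subtopology covers: the least
formal-topology cover containing all of them. -/
def covMeet {S : Type*} {ι : Sort*} (le : S → S → Prop)
    (F : ι → (S → Set S → Prop)) : S → Set S → Prop :=
  fun a U => ∀ c : S → Set S → Prop,
    IsFTCover c le → (∀ i : ι, ∀ (a' : S) (U' : Set S), F i a' U' → c a' U') → c a U

/-- the closed subtopology `C_a` determined by `{a}`. -/
def closedCov {S : Type*} (cov : S → Set S → Prop) (a : S) : S → Set S → Prop :=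
  fun c V => cov c ({a} ∪ V)

/-- the open subtopology `S_B` determined by a finite `B`. -/
def openCov {S : Type*} (cov : S → Set S → Prop) (le : S → S → Prop)
    (B : Finset S) : S → Set S → Prop :=
  fun c V => covS cov (down le {c} ↑B) V

/-- `K_A = ⋀_{A ≪ B} S_B`. -/
def KCov {S : Type*} (cov : S → Set S → Prop) (le : S → S → Prop) (A : Finset S) :
    S → Set S → Prop :=
  covMeet le (fun B : {B : Finset S // wbS cov ↑A ↑B} => openCov cov le B.1)

/-- `C_a ∨ K_A` (the join of subtopologies is the intersection of covers). -/
def CKCov {S : Type*} (cov : S → Set S → Prop) (le : S → S → Prop)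
    (a : S) (A : Finset S) : S → Set S → Prop :=
  fun c V => closedCov cov a c V ∧ KCov cov le A c V

/-- perfect subtopologies. -/
def IsPerfectSub {S : Type*} (cov : S → Set S → Prop) (le : S → S → Prop)
    (cov' : S → Set S → Prop) : Prop :=
  IsFTCover cov' le ∧ (∀ (a : S) (U : Set S), cov a U → cov' a U) ∧
  (∀ a b : S, wb cov a b → wb cov' a b)

/-- the order of `PSub(S)`: `(a,A) ≤ (b,B)` iff `C_b ∨ K_B ⊑ C_a ∨ K_A`. -/
def PSubLe {S : Type*} (cov : S → Set S → Prop) (le : S → S → Prop) :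
    S × Finset S → S × Finset S → Prop :=
  fun p q => ∀ (c : S) (V : Set S), CKCov cov le p.1 p.2 c V → CKCov cov le q.1 q.2 c V

/-- the cover of `PSub(S)`: `(a,A) ◁ U` iff `⋀{C_b ∨ K_B | (b,B) ∈ U} ⊑ C_a ∨ K_A`. -/
def covPSub {S : Type*} (cov : S → Set S → Prop) (le : S → S → Prop) :
    S × Finset S → Set (S × Finset S) → Prop :=
  fun p U => ∀ (c : S) (V : Set S), CKCov cov le p.1 p.2 c V →
    covMeet le (fun q : U => CKCov cov le q.1.1 q.1.2) c V

/-- the map `r : PSub(S) → Patch(S)` on generators. -/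
def rGenPS {S : Type*} (cov : S → Set S → Prop) (le : S → S → Prop)
    (p : S × Finset S) : PatchGen S → Prop
  | PatchGen.r b => covPSub cov le p {((b, (∅ : Finset S)) : S × Finset S)}
  | PatchGen.l B => covPSub cov le p {q : S × Finset S | q.2 = B}

/-- the map `r : PSub(S) → Patch(S)`, extended along the presentation. -/
def rPS {S : Type*} (cov : S → Set S → Prop) (le : S → S → Prop) :
    S × Finset S → Finset (PatchGen S) → Prop :=
  fun p 𝔅 => ∀ g ∈ 𝔅, covPSub cov le p (rinv (fun q g' => rGenPS cov le q g') {g})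

/-- the map `s : Patch(S) → PSub(S)`. -/
def sPS {S : Type*} (cov : S → Set S → Prop) (le : S → S → Prop) :
    Finset (PatchGen S) → (S × Finset S) → Prop :=
  fun 𝔄 p => patchCov cov le 𝔄
    ({({PatchGen.r p.1, PatchGen.l p.2} : Finset (PatchGen S))} : Set (Finset (PatchGen S)))

/-! ### Saturated subsets, dcpos and preframes -/

/-- the saturated subsets of a basic cover. -/
abbrev SatSet {α : Type*} (cov : α → Set α → Prop) : Type _ :=
  {U : Set α // ∀ a, cov a U → a ∈ U}

/-- the join of a family of saturated subsets. -/
def satSup {α : Type*} {cov : α → Set α → Prop} (hbc : IsBasicCover cov)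
    (D : Set (SatSet cov)) : SatSet cov :=
  ⟨{a | cov a (⋃ U ∈ D, (U : Set α))}, fun a h => hbc.2 a _ _ h (fun _ hb => hb)⟩

/-- inductively generated basic covers: `BGen Ax` is the cover generated by the
axiom-set with axioms `a ◁ C` for `C ∈ Ax a`. -/
inductive BGen {S : Type*} (Ax : S → Set (Set S)) : S → Set S → Prop where
  | refl {a : S} {U : Set S} : a ∈ U → BGen Ax a U
  | infty {a : S} {U : Set S} (C : Set S) :
      C ∈ Ax a → (∀ b ∈ C, BGen Ax b U) → BGen Ax a U

theorem BGen_trans {S : Type*} {Ax : S → Set (Set S)} {a : S} {U V : Set S}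
    (h : BGen Ax a U) (h' : ∀ b ∈ U, BGen Ax b V) : BGen Ax a V := by
  induction h with
  | refl ha => exact h' _ ha
  | infty C hC _ ih => exact BGen.infty C hC (fun b hb => ih b hb h')

theorem BGen_isBasicCover {S : Type*} (Ax : S → Set (Set S)) :
    IsBasicCover (BGen Ax) :=
  ⟨fun _ _ h => BGen.refl h, fun _ _ _ h h' => BGen_trans h h'⟩

/-- the lower powerlocale theory of an inductively generated basic cover. -/
inductive LowerThyAx {S : Type*} (Ax : S → Set (Set S)) :
    Finset S → Set (Finset S) → Prop where
  | mk (a : S) (C : Set S) :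
      C ∈ Ax a → LowerThyAx Ax {a} {B | ∃ b ∈ C, B = ({b} : Finset S)}

/-- the counit `σ_L : Lower(S) → S` for an inductively generated basic cover. -/
def sigmaLAx {S : Type*} (Ax : S → Set (Set S)) : Finset S → S → Prop :=
  fun A a => GCov (LowerThyAx Ax) A ({({a} : Finset S)} : Set (Finset S))

/-- the top saturated subset of a presented topology. -/
def satTop {P : Type*} (T : Finset P → Set (Finset P) → Prop) : SatSet (GCov T) :=
  ⟨Set.univ, fun _ _ => Set.mem_univ _⟩

/-- binary meets of saturated subsets of a presented topology. -/
def satInfL {P : Type*} (T : Finset P → Set (Finset P) → Prop)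
    (U V : SatSet (GCov T)) : SatSet (GCov T) :=
  ⟨{A | GCov T A (down supord (U : Set (Finset P)) (V : Set (Finset P)))},
   fun _ h => GCov_trans h (fun _ hB => hB)⟩

/-- the suplattice homomorphism `σ_L* : Sat(S) → Sat(Lower(S))`. -/
def sigmaStar {S : Type*} (Ax : S → Set (Set S)) (U : SatSet (BGen Ax)) :
    SatSet (GCov (LowerThyAx Ax)) :=
  ⟨{A : Finset S | GCov (LowerThyAx Ax) A (rinv (sigmaLAx Ax) (U : Set S))},
   fun _ h => GCov_trans h (fun _ hB => hB)⟩

/-- a preframe structure on a partial order: finite meets and directed joins,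
with finite meets distributing over directed joins. -/
structure PreframeStr (X : Type*) [PartialOrder X] where
  top : X
  inf : X → X → X
  dSup : Set X → X
  le_top : ∀ x, x ≤ top
  inf_le_left : ∀ x y, inf x y ≤ x
  inf_le_right : ∀ x y, inf x y ≤ y
  le_inf : ∀ x y z, x ≤ y → x ≤ z → x ≤ inf y z
  le_dSup : ∀ d : Set X, d.Nonempty → DirectedOn (· ≤ ·) d → ∀ x ∈ d, x ≤ dSup d
  dSup_le : ∀ d : Set X, d.Nonempty → DirectedOn (· ≤ ·) d →
    ∀ z, (∀ x ∈ d, x ≤ z) → dSup d ≤ z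
  distrib : ∀ (x : X) (d : Set X), d.Nonempty → DirectedOn (· ≤ ·) d →
    inf x (dSup d) = dSup ((fun y => inf x y) '' d)

/-- dcpo homomorphisms out of `Sat(S)`. -/
def IsDcpoHom {α : Type*} {cov : α → Set α → Prop} (hbc : IsBasicCover cov)
    {X : Type*} [PartialOrder X] (PF : PreframeStr X) (f : SatSet cov → X) : Prop :=
  Monotone f ∧
  ∀ D : Set (SatSet cov), D.Nonempty → DirectedOn (· ≤ ·) D →
    f (satSup hbc D) = PF.dSup (f '' D)

/-- preframe homomorphisms out of the frame of a presented topology. -/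
def IsPreframeHomL {P : Type*} (T : Finset P → Set (Finset P) → Prop)
    {X : Type*} [PartialOrder X] (PF : PreframeStr X)
    (F : SatSet (GCov T) → X) : Prop :=
  Monotone F ∧ F (satTop T) = PF.top ∧
  (∀ U V, F (satInfL T U V) = PF.inf (F U) (F V)) ∧
  ∀ D : Set (SatSet (GCov T)), D.Nonempty → DirectedOn (· ≤ ·) D →
    F (satSup (GCov_isBasicCover T) D) = PF.dSup (F '' D)

/-! ### Located subsets: auxiliary notions -/

/-- the lower part `L_V` associated to a located subset `V`. -/
def LV {S : Type*} (cov : S → Set S → Prop) (V : Set S) : Set S :=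
  {a | ∃ A : Finset S, wbS cov {a} ↑A ∧ (↑A ∩ V : Set S) = ∅}

/-- cuts of a continuous basic cover. -/
def IsCut {S : Type*} (cov : S → Set S → Prop) (L U : Set S) : Prop :=
  (∀ (a : S) (A : Finset S), cov a ↑A → a ∈ U → ((↑A : Set S) ∩ U).Nonempty) ∧
  (∀ a ∈ U, ∃ b : S, wb cov b a ∧ b ∈ U) ∧
  (∀ (a : S) (A : Finset S), cov a ↑A → (↑A : Set S) ⊆ L → a ∈ L) ∧
  (∀ a ∈ L, ∃ A : Finset S, wbS cov {a} ↑A ∧ (↑A : Set S) ⊆ L) ∧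
  (∀ a b : S, wb cov a b → a ∈ L ∨ b ∈ U) ∧
  L ∩ U = ∅

end FTP

namespace FTP

/-! ### Calculus of covers and of the way-below relation -/

section Cover

variable {S : Type*} {cov : S → Set S → Prop} {le : S → S → Prop}

/-- The saturation of a subset. -/
def sat (cov : S → Set S → Prop) (U : Set S) : Set S := {a | cov a U}

theorem covS_trans (hbc : IsBasicCover cov) {U V W : Set S}
    (h : covS cov U V) (h' : covS cov V W) : covS cov U W :=
  fun a ha => hbc.2 a V W (h a ha) h'

theorem covS_of_subset (hbc : IsBasicCover cov) {U V : Set S} (h : U ⊆ V) : covS cov U V :=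
  fun a ha => hbc.1 a V (h ha)

theorem wbS_of_covS_left (hbc : IsBasicCover cov) {U U' V : Set S}
    (h : covS cov U U') (h' : wbS cov U' V) : wbS cov U V := fun W hW => by
  obtain ⟨W₀, hW₀, hc⟩ := h' W hW
  exact ⟨W₀, hW₀, covS_trans hbc h hc⟩

theorem wbS_of_covS_right (hbc : IsBasicCover cov) {U V V' : Set S}
    (h : wbS cov U V) (h' : covS cov V V') : wbS cov U V' :=
  fun W hW => h W (covS_trans hbc h' hW)

theorem covS_of_wbS (hbc : IsBasicCover cov) {U V : Set S} (h : wbS cov U V) :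
    covS cov U V := by
  obtain ⟨W₀, hW₀, hc⟩ := h V (covS_of_subset hbc subset_rfl)
  exact covS_trans hbc hc (covS_of_subset hbc hW₀)

/-- A finite union of subsets way below `V` is way below `V`. -/
theorem wbS_biUnion (hbc : IsBasicCover cov) {ι : Type*} (s : Finset ι) (f : ι → Set S)
    {V : Set S} (h : ∀ i ∈ s, wbS cov (f i) V) : wbS cov (⋃ i ∈ s, f i) V := fun W hW => by
  choose! g hg hc using fun i hi => h i hi W hW
  refine ⟨s.biUnion g, ?_, ?_⟩
  · intro x hx
    simp only [Finset.coe_biUnion, Set.mem_iUnion] at hx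
    obtain ⟨i, hi, hx⟩ := hx
    exact hg i hi hx
  · intro x hx
    simp only [Set.mem_iUnion] at hx
    obtain ⟨i, hi, hx⟩ := hx
    exact covS_trans hbc (hc i hi)
      (covS_of_subset hbc (Finset.coe_subset.2 (Finset.subset_biUnion_of_mem g hi))) x hx

theorem wbS_union (hbc : IsBasicCover cov) {U U' V : Set S} (h : wbS cov U V)
    (h' : wbS cov U' V) : wbS cov (U ∪ U') V := by
  refine wbS_of_covS_left hbc ?_
    (wbS_biUnion hbc Finset.univ (fun b : Bool => if b then U else U') ?_)
  · exact covS_of_subset hbc (Set.union_subset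
      (fun x hx => Set.mem_biUnion (Finset.mem_univ true) (by simpa using hx))
      (fun x hx => Set.mem_biUnion (Finset.mem_univ false) (by simpa using hx)))
  · rintro (_ | _) _ <;> simpa

theorem wbS_finset (hbc : IsBasicCover cov) (F : Finset S) {V : Set S}
    (h : ∀ a ∈ F, ∃ b ∈ V, wb cov a b) : wbS cov ↑F V := by
  refine wbS_of_covS_left hbc (covS_of_subset hbc fun x hx => ?_)
    (wbS_biUnion hbc F (fun a => {a}) ?_)
  · exact Set.mem_biUnion hx rfl
  · intro a ha W hW
    obtain ⟨b, hb, hab⟩ := h a ha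
    obtain ⟨W₀, hW₀, hc⟩ := hab W (hW b hb)
    exact ⟨W₀, hW₀, by rintro _ rfl; exact hc⟩

/-- The way-below relation of a continuous basic cover refines to elements. -/
theorem exists_finset_wb {w : S → Set S} (hbc : IsBasicCover cov) (hw : IsContinuous cov w)
    {U V : Set S} (h : wbS cov U V) :
    ∃ F : Finset S, covS cov U ↑F ∧ ∀ a ∈ F, ∃ b ∈ V, wb cov a b := by
  obtain ⟨F, hF, hc⟩ := h (⋃ b ∈ V, w b) fun b hb =>
    hbc.2 b _ _ (hw.2 b) (covS_of_subset hbc (Set.subset_biUnion_of_mem hb))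
  refine ⟨F, hc, fun a ha => ?_⟩
  obtain ⟨b, hb, hab⟩ := Set.mem_iUnion₂.1 (hF ha)
  exact ⟨b, hb, hw.1 b a hab⟩

theorem wbS_interpolate {w : S → Set S} (hbc : IsBasicCover cov) (hw : IsContinuous cov w)
    {U V : Set S} (h : wbS cov U V) :
    ∃ F : Finset S, wbS cov U ↑F ∧ wbS cov ↑F V := by
  have key : wbS cov U (⋃ b ∈ V, w b) := wbS_of_covS_right hbc h fun b hb =>
    hbc.2 b _ _ (hw.2 b) (covS_of_subset hbc (Set.subset_biUnion_of_mem hb))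
  obtain ⟨F, hUF, hF⟩ := exists_finset_wb hbc hw key
  choose! x hx hwb using hF
  refine ⟨F.image x, wbS_of_covS_left hbc hUF (wbS_finset hbc F fun a ha =>
    ⟨x a, by simpa using ⟨a, ha, rfl⟩, hwb a ha⟩), wbS_finset hbc _ fun c hc => ?_⟩
  obtain ⟨a, ha, rfl⟩ := Finset.mem_image.1 hc
  obtain ⟨b, hb, hab⟩ := Set.mem_iUnion₂.1 (hx a ha)
  exact ⟨b, hb, hw.1 b _ hab⟩

theorem cov_mono_le (hft : IsFormalTopology cov le) {a b : S} {U : Set S} (h : le a b)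
    (hb : cov b U) : cov a U :=
  hft.1.2 a {b} U (hft.2.2.2.1 a b h) (by rintro _ rfl; exact hb)

/-- Stability of the way-below relation, for subsets. -/
theorem wbS_sat_inter {w : S → Set S} (hft : IsFormalTopology cov le)
    (hw : IsContinuous cov w) (hst : Stable cov le) {U U' V V' : Set S}
    (h : wbS cov U U') (h' : wbS cov V V') :
    wbS cov (sat cov U ∩ sat cov V) (sat cov U' ∩ sat cov V') := by
  have hbc := hft.1
  obtain ⟨F, hUF, hF⟩ := exists_finset_wb hbc hw h
  obtain ⟨G, hVG, hG⟩ := exists_finset_wb hbc hw h'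
  refine wbS_of_covS_left hbc (U' := ⋃ p ∈ F ×ˢ G, down le {p.1} {p.2}) ?_
    (wbS_biUnion hbc _ _ ?_)
  · rintro c ⟨hcU, hcV⟩
    refine hbc.2 c _ _
      (hft.2.2.2.2 c _ _ (hbc.2 c _ _ hcU hUF) (hbc.2 c _ _ hcV hVG))
      (covS_of_subset hbc ?_)
    rintro x ⟨a, ha, b, hb, hxa, hxb⟩
    exact Set.mem_biUnion (x := (a, b)) (Finset.mem_product.2 ⟨ha, hb⟩)
      ⟨a, rfl, b, rfl, hxa, hxb⟩
  · rintro ⟨a, b⟩ hp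
    obtain ⟨ha, hb⟩ := Finset.mem_product.1 hp
    obtain ⟨a', ha', haa'⟩ := hF a ha
    obtain ⟨b', hb', hbb'⟩ := hG b hb
    refine wbS_of_covS_right hbc (hst a a' b b' haa' hbb') (covS_of_subset hbc ?_)
    rintro x ⟨_, rfl, _, rfl, hxa, hxb⟩
    exact ⟨cov_mono_le hft hxa (hbc.1 _ _ ha'), cov_mono_le hft hxb (hbc.1 _ _ hb')⟩

/-- In a stably compact formal topology the subsets that `U` is way below are closed under
finite meets. -/
theorem wbS_biInter_sat {w : S → Set S} (hft : IsFormalTopology cov le)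
    (hw : IsContinuous cov w) (hcomp : Compact cov) (hst : Stable cov le)
    {ι : Type*} (s : Finset ι) (f : ι → Set S) {U : Set S}
    (h : ∀ i ∈ s, wbS cov U (f i)) : wbS cov U (⋂ i ∈ s, sat cov (f i)) := by
  have hbc := hft.1
  induction s using Finset.induction_on with
  | empty =>
    simpa using wbS_of_covS_left hbc (covS_of_subset hbc (Set.subset_univ U)) hcomp
  | insert i s _ ih =>
    have h₁ := h i (Finset.mem_insert_self i s)
    have h₂ := ih fun j hj => h j (Finset.mem_insert_of_mem hj)
    refine wbS_of_covS_right hbc (wbS_of_covS_left hbc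
      (U' := sat cov U ∩ sat cov U)
      (covS_of_subset hbc fun a ha => ⟨hbc.1 a U ha, hbc.1 a U ha⟩)
      (wbS_sat_inter hft hw hst h₁ h₂)) ?_
    rintro a ⟨hai, has⟩
    refine hbc.2 a _ _ (hft.2.2.2.2 a _ _ hai has) ?_
    rintro x ⟨b, hb, c, hc, hxb, hxc⟩
    refine hbc.1 _ _ ?_
    simp only [Finset.mem_insert, Set.iInter_iInter_eq_or_left, Set.mem_inter_iff,
      Set.mem_iInter] at hc ⊢
    exact ⟨cov_mono_le hft hxb (hbc.1 _ _ hb), fun j hj => cov_mono_le hft hxc (hc j hj)⟩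

/-- Binary joins distribute over finite meets. -/
theorem cov_union_biInter_sat (hft : IsFormalTopology cov le) {ι : Type*} (s : Finset ι)
    (f : ι → Set S) {U : Set S} {a : S} (h : ∀ i ∈ s, cov a (U ∪ f i)) :
    cov a (U ∪ ⋂ i ∈ s, sat cov (f i)) := by
  have hbc := hft.1
  induction s using Finset.induction_on with
  | empty => exact hbc.1 _ _ (by simp)
  | insert i s _ ih =>
    have h₁ := h i (Finset.mem_insert_self i s)
    have h₂ := ih fun j hj => h j (Finset.mem_insert_of_mem hj)
    refine hbc.2 a _ _ (hft.2.2.2.2 a _ _ h₁ h₂) ?_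
    rintro x ⟨b, hb, c, hc, hxb, hxc⟩
    rcases hb with hb | hb
    · exact cov_mono_le hft hxb (hbc.1 _ _ (Or.inl hb))
    rcases hc with hc | hc
    · exact cov_mono_le hft hxc (hbc.1 _ _ (Or.inl hc))
    refine hbc.1 _ _ (Or.inr ?_)
    simp only [Finset.mem_insert, Set.iInter_iInter_eq_or_left, Set.mem_inter_iff,
      Set.mem_iInter] at hc ⊢
    exact ⟨cov_mono_le hft hxb (hbc.1 _ _ hb), fun j hj => cov_mono_le hft hxc (hc j hj)⟩

theorem cov_lowerBounds (hft : IsFormalTopology cov le) {ι : Type*} (s : Finset ι)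
    (g : ι → Set S) {a : S} (h : ∀ i ∈ s, cov a (g i)) :
    cov a {c | ∀ i ∈ s, ∃ b ∈ g i, le c b} := by
  have hbc := hft.1
  induction s using Finset.induction_on with
  | empty => exact hbc.1 _ _ (by simp)
  | insert i s _ ih =>
    have h₁ := h i (Finset.mem_insert_self i s)
    have h₂ := ih fun j hj => h j (Finset.mem_insert_of_mem hj)
    refine hbc.2 a _ _ (hft.2.2.2.2 a _ _ h₁ h₂) (covS_of_subset hbc ?_)
    rintro x ⟨b, hb, c, hc, hxb, hxc⟩ j hj
    rcases Finset.mem_insert.1 hj with rfl | hj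
    · exact ⟨b, hb, hxb⟩
    · obtain ⟨d, hd, hcd⟩ := hc j hj
      exact ⟨d, hd, hft.2.2.1 hxc hcd⟩

/-- The finite join of Scott open filters, in terms of saturations. -/
theorem mem_finJoin_iff (hft : IsFormalTopology cov le) (hcomp : Compact cov)
    {𝒜 : Finset (Finset S)} {B : Finset S} :
    B ∈ finJoin cov le 𝒜 ↔ ∃ g : Finset S → Finset S, (∀ A ∈ 𝒜, wbS cov ↑A ↑(g A)) ∧
      wbS cov (⋂ A ∈ 𝒜, sat cov ↑(g A)) ↑B := by
  have hbc := hft.1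
  by_cases h𝒜 : 𝒜 = ∅
  · subst h𝒜
    simp only [finJoin, if_true, Set.mem_ofPred_eq, Finset.notMem_empty, false_imp_iff,
      implies_true, true_and, Set.iInter_of_empty, Set.iInter_univ, exists_const]
    exact ⟨fun h => wbS_of_covS_right hbc hcomp h, covS_of_wbS hbc⟩
  · simp only [finJoin, if_neg h𝒜, Set.mem_ofPred_eq]
    refine exists_congr fun g => and_congr_right fun _ => ⟨fun h => ?_, fun h => ?_⟩
    · refine wbS_of_covS_left hbc (fun c hc => ?_) h
      exact cov_lowerBounds hft 𝒜 (fun A => (g A : Set S)) (Set.mem_iInter₂.1 hc)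
    · refine wbS_of_covS_left hbc (covS_of_subset hbc fun c hc => ?_) h
      refine Set.mem_iInter₂.2 fun A hA => ?_
      obtain ⟨b, hb, hcb⟩ := hc A hA
      exact cov_mono_le hft hcb (hbc.1 _ _ hb)

theorem upF_subset_finJoin_singleton {w : S → Set S} (hft : IsFormalTopology cov le)
    (hw : IsContinuous cov w) (hcomp : Compact cov) {A B : Finset S}
    (h : covS cov ↑A ↑B) : upF cov B ⊆ finJoin cov le {A} := fun E hE => by
  obtain ⟨F, hBF, hFE⟩ := wbS_interpolate hft.1 hw hE
  refine (mem_finJoin_iff hft hcomp).2 ⟨fun _ => F, ?_, ?_⟩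
  · simpa using wbS_of_covS_left hft.1 h hBF
  · exact wbS_of_covS_left hft.1 (fun a ha => by simpa [sat] using ha) hFE

/-! ### The cover of the de Groot dual -/

theorem DCov_localize {A : Finset S} {𝒰 𝒱 : Set (Finset S)} (h : DCov cov le A 𝒰) :
    ∀ A' : Finset S, A ⊆ A' →
      (∀ C : Finset S, A' ⊆ C → (∃ B ∈ 𝒰, B ⊆ C) → DCov cov le C 𝒱) →
      DCov cov le A' 𝒱 := by
  induction h with
  | @refl A 𝒰 hA => exact fun A' hAA' H => H A' subset_rfl ⟨A, hA, hAA'⟩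
  | le hBA _ ih => exact fun A' hAA' H => ih A' (hBA.trans hAA') H
  | d3 hA _ ih =>
    exact fun A' hAA' H => DCov.d3 (hA.trans hAA') fun C hC hB =>
      ih C (hAA'.trans hC) hB C subset_rfl fun D hD => H D (hC.trans hD)
  | d4 hA hJ _ ih =>
    exact fun A' hAA' H => DCov.d4 (hA.trans hAA') hJ fun C hC hB =>
      ih C (hAA'.trans hC) hB C subset_rfl fun D hD => H D (hC.trans hD)

theorem DCov_trans {A : Finset S} {𝒰 𝒱 : Set (Finset S)} (h : DCov cov le A 𝒰)
    (h' : ∀ B ∈ 𝒰, DCov cov le B 𝒱) : DCov cov le A 𝒱 :=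
  DCov_localize h A subset_rfl fun _ _ ⟨B, hB, hBC⟩ => DCov.le hBC (h' B hB)

theorem DCov_upF (A : Finset S) : DCov cov le A (upF cov A) :=
  DCov.d3 subset_rfl fun _ _ ⟨_, hAB, hBC⟩ => DCov.le hBC (DCov.refl hAB)

theorem DCov_of_upF_subset {A : Finset S} {𝒜 : Finset (Finset S)}
    (h : upF cov A ⊆ finJoin cov le 𝒜) : DCov cov le A ↑𝒜 :=
  DCov.d4 subset_rfl h fun _ _ ⟨_, hB, hBC⟩ => DCov.le hBC (DCov.refl hB)

/-- If the filter of `A` lies below a join of filters, and each of these, joined with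
that of `A`, is finitely covered by `𝒰`, then so is the filter of `A`. -/
theorem exists_upF_subset_finJoin {w : S → Set S} (hft : IsFormalTopology cov le)
    (hw : IsContinuous cov w) (hcomp : Compact cov) (hst : Stable cov le)
    {A : Finset S} {𝒜 : Finset (Finset S)} {𝒰 : Set (Finset S)}
    (hA : upF cov A ⊆ finJoin cov le 𝒜)
    (h : ∀ B ∈ 𝒜, ∀ E : Finset S, wbS cov ↑(A ∪ B) ↑E →
      ∃ 𝒰₀ : Finset (Finset S), ↑𝒰₀ ⊆ 𝒰 ∧ upF cov E ⊆ finJoin cov le 𝒰₀)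
    {E : Finset S} (hE : wbS cov ↑A ↑E) :
    ∃ 𝒰₀ : Finset (Finset S), ↑𝒰₀ ⊆ 𝒰 ∧ upF cov E ⊆ finJoin cov le 𝒰₀ := by
  have hbc := hft.1
  obtain ⟨E', hAE', hE'E⟩ := wbS_interpolate hbc hw hE
  obtain ⟨g, hg, hgE'⟩ := (mem_finJoin_iff hft hcomp).1 (hA hAE')
  have hfin : ∀ B ∈ 𝒜, ∃ 𝒰₀ : Finset (Finset S), ↑𝒰₀ ⊆ 𝒰 ∧
      E ∪ g B ∈ finJoin cov le 𝒰₀ := by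
    intro B hB
    obtain ⟨G, hBG, hGg⟩ := wbS_interpolate hbc hw (hg B hB)
    have union_wbS : ∀ {X Y X' Y' : Finset S}, wbS cov ↑X ↑X' → wbS cov ↑Y ↑Y' →
        wbS cov ↑(X ∪ Y) ↑(X' ∪ Y') := by
      intro X Y X' Y' hX hY
      rw [Finset.coe_union, Finset.coe_union]
      exact wbS_union hbc
        (wbS_of_covS_right hbc hX (covS_of_subset hbc Set.subset_union_left))
        (wbS_of_covS_right hbc hY (covS_of_subset hbc Set.subset_union_right))
    obtain ⟨𝒰₀, h𝒰₀, hsub⟩ := h B hB (E' ∪ G) (union_wbS hAE' hBG)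
    exact ⟨𝒰₀, h𝒰₀, hsub (union_wbS hE'E hGg)⟩
  choose! 𝒲 h𝒲 hmem using hfin
  simp only [mem_finJoin_iff hft hcomp] at hmem
  choose! k hk hkE using hmem
  have hcommon : ∀ C : Finset S, ∃ H : Finset S, wbS cov ↑C ↑H ∧
      ∀ B ∈ 𝒜, C ∈ 𝒲 B → covS cov ↑H ↑(k B C) := by
    intro C
    obtain ⟨H, hCH, hH⟩ := wbS_interpolate hbc hw <|
      wbS_biInter_sat hft hw hcomp hst (𝒜.filter fun B => C ∈ 𝒲 B)
        (fun B => (k B C : Set S)) (U := (C : Set S)) fun B hB =>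
          hk B (Finset.mem_filter.1 hB).1 C (Finset.mem_filter.1 hB).2
    refine ⟨H, hCH, fun B hB hC => covS_trans hbc (covS_of_wbS hbc hH) fun a ha => ?_⟩
    exact Set.mem_iInter₂.1 ha B (Finset.mem_filter.2 ⟨hB, hC⟩)
  choose H hCH hH using hcommon
  refine ⟨𝒜.biUnion 𝒲, ?_, fun F hF => (mem_finJoin_iff hft hcomp).2
    ⟨H, fun C _ => hCH C, ?_⟩⟩
  · intro C hC
    obtain ⟨B, hB, hCB⟩ := Finset.mem_biUnion.1 hC
    exact h𝒲 B hB hCB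
  refine wbS_of_covS_left hbc (U' := (E : Set S)) ?_ hF
  intro a ha
  have hcov : ∀ B ∈ 𝒜, cov a (↑E ∪ ↑(g B)) := by
    intro B hB
    rw [← Finset.coe_union]
    refine covS_of_wbS hbc (hkE B hB) a (Set.mem_iInter₂.2 fun C hC => ?_)
    exact hbc.2 a _ _ (Set.mem_iInter₂.1 ha C (Finset.mem_biUnion.2 ⟨B, hB, hC⟩))
      (hH C B hB hC)
  refine hbc.2 a _ _ (cov_union_biInter_sat hft 𝒜 (fun B => (g B : Set S)) hcov) ?_
  rintro x (hx | hx)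
  · exact hbc.1 x _ hx
  · exact covS_trans hbc (covS_of_wbS hbc hgE') (covS_of_wbS hbc hE'E) x hx

theorem DCov_iff {w : S → Set S} (hft : IsFormalTopology cov le)
    (hw : IsContinuous cov w) (hcomp : Compact cov) (hst : Stable cov le)
    (A : Finset S) (𝒰 : Set (Finset S)) :
    DCov cov le A 𝒰 ↔ ∀ B : Finset S, wbS cov ↑A ↑B →
      ∃ 𝒰₀ : Finset (Finset S), ↑𝒰₀ ⊆ 𝒰 ∧ upF cov B ⊆ finJoin cov le 𝒰₀ := by
  have hbc := hft.1
  have anti : ∀ {X Y : Finset S} {V : Set S}, X ⊆ Y → wbS cov ↑Y V → wbS cov ↑X V :=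
    fun hXY hY => wbS_of_covS_left hbc (covS_of_subset hbc (Finset.coe_subset.2 hXY)) hY
  refine ⟨fun h => ?_, fun h => DCov_trans (DCov_upF A) fun B hB => ?_⟩
  · induction h with
    | @refl A 𝒰 hA =>
      exact fun B hB => ⟨{A}, by simpa using hA,
        upF_subset_finJoin_singleton hft hw hcomp (covS_of_wbS hbc hB)⟩
    | le hBA _ ih => exact fun B hB => ih B (anti hBA hB)
    | @d3 A A' 𝒰 hA _ ih =>
      intro E hE
      obtain ⟨F, hF, hFE⟩ := wbS_interpolate hbc hw hE
      refine ih (A' ∪ F) Finset.subset_union_left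
        ⟨F, anti hA hF, Finset.subset_union_right⟩ E ?_
      rw [Finset.coe_union]
      exact wbS_union hbc hE hFE
    | @d4 A A' 𝒜 𝒰 hA hJ _ ih =>
      exact fun E hE => exists_upF_subset_finJoin hft hw hcomp hst
        (fun F hF => hJ (anti hA hF))
        (fun B hB => ih (A' ∪ B) Finset.subset_union_left
          ⟨B, hB, Finset.subset_union_right⟩) hE
  · obtain ⟨𝒰₀, h𝒰₀, hsub⟩ := h B hB
    exact DCov_trans (DCov_of_upF_subset hsub) fun C hC => DCov.refl (h𝒰₀ hC)

theorem wb_DCov_of_wbS {w : S → Set S} (hft : IsFormalTopology cov le)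
    (hw : IsContinuous cov w) (hcomp : Compact cov) (hst : Stable cov le)
    {A B : Finset S} (h : wbS cov ↑A ↑B) : wb (DCov cov le) B A := fun 𝒰 h𝒰 => by
  obtain ⟨𝒰₀, h𝒰₀, hsub⟩ := (DCov_iff hft hw hcomp hst A 𝒰).1 h𝒰 B h
  exact ⟨𝒰₀, h𝒰₀, DCov_of_upF_subset hsub⟩

theorem exists_wbS_of_wb_DCov {w : S → Set S} (hft : IsFormalTopology cov le)
    (hw : IsContinuous cov w) (hcomp : Compact cov) (hst : Stable cov le)
    {A B : Finset S} (h : wb (DCov cov le) B A) :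
    ∃ C : Finset S, wbS cov ↑A ↑C ∧ DCov cov le B {C} := by
  obtain ⟨𝒰₀, h𝒰₀, hB⟩ := h _ (DCov_upF A)
  obtain ⟨C, hAC, hC⟩ := wbS_interpolate hft.1 hw <|
    wbS_biInter_sat hft hw hcomp hst 𝒰₀ (fun D => (D : Set S)) fun D hD => h𝒰₀ hD
  refine ⟨C, hAC, DCov_trans hB fun D hD => ?_⟩
  have hCD : covS cov ↑C ↑D := covS_trans hft.1 (covS_of_wbS hft.1 hC)
    fun a ha => Set.mem_iInter₂.1 ha D hD
  simpa using DCov_of_upF_subset (upF_subset_finJoin_singleton hft hw hcomp hCD)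

theorem compact_DCov {w : S → Set S} (hft : IsFormalTopology cov le)
    (hw : IsContinuous cov w) (hcomp : Compact cov) (hst : Stable cov le) :
    Compact (DCov cov le) := fun 𝒲 h𝒲 => by
  obtain ⟨𝒲₀, h𝒲₀, hc⟩ := wb_DCov_of_wbS (A := ∅) (B := ∅) hft hw hcomp hst
    (wbS_finset hft.1 ∅ (by simp)) 𝒲 (h𝒲 ∅ trivial)
  exact ⟨𝒲₀, h𝒲₀, fun A _ => DCov.le A.empty_subset hc⟩

theorem stable_DCov {w : S → Set S} (hft : IsFormalTopology cov le)
    (hw : IsContinuous cov w) (hcomp : Compact cov) (hst : Stable cov le) :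
    Stable (DCov cov le) supord := by
  intro A A' B B' hA hB 𝒲 h𝒲
  have hbc := hft.1
  obtain ⟨C, hAC, hC⟩ := exists_wbS_of_wb_DCov hft hw hcomp hst hA
  obtain ⟨D, hBD, hD⟩ := exists_wbS_of_wb_DCov hft hw hcomp hst hB
  have hwb : wbS cov ↑(A' ∪ B') ↑(C ∪ D) := by
    rw [Finset.coe_union, Finset.coe_union]
    exact wbS_union hbc
      (wbS_of_covS_right hbc hAC (covS_of_subset hbc Set.subset_union_left))
      (wbS_of_covS_right hbc hBD (covS_of_subset hbc Set.subset_union_right))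
  obtain ⟨𝒲₀, h𝒲₀, hc⟩ := wb_DCov_of_wbS hft hw hcomp hst hwb 𝒲 <| h𝒲 _
    ⟨A', rfl, B', rfl, Finset.subset_union_left, Finset.subset_union_right⟩
  refine ⟨𝒲₀, h𝒲₀, ?_⟩
  rintro E ⟨_, rfl, _, rfl, hEA, hEB⟩
  refine DCov_localize hC E hEA ?_
  rintro F hEF ⟨_, rfl, hCF⟩
  refine DCov_localize hD F (Finset.Subset.trans hEB hEF) ?_
  rintro G hFG ⟨_, rfl, hDG⟩
  exact DCov.le (Finset.union_subset (hCF.trans hFG) hDG) hc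

end Cover

/-- Characterisation of the cover of the de Groot dual `S^D` of a
stably compact formal topology, and stable compactness of `S^D`. -/
theorem deGroot_dual_cover_char {S : Type u}
    (cov : S → Set S → Prop) (le : S → S → Prop)
    (hft : IsFormalTopology cov le) (w : S → Set S) (hw : IsContinuous cov w)
    (hcomp : Compact cov) (hst : Stable cov le) :
    (∀ (A : Finset S) (𝒰 : Set (Finset S)),
      DCov cov le A 𝒰 ↔
        ∀ B : Finset S, wbS cov ↑A ↑B →
          ∃ 𝒰₀ : Finset (Finset S), ↑𝒰₀ ⊆ 𝒰 ∧ upF cov B ⊆ finJoin cov le 𝒰₀) ∧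
    Compact (DCov cov le) ∧
    (∃ wD : Finset S → Set (Finset S), IsContinuous (DCov cov le) wD) ∧
    Stable (DCov cov le) supord := by
  exact ⟨DCov_iff hft hw hcomp hst, compact_DCov hft hw hcomp hst,
    ⟨upF cov, fun _ _ => wb_DCov_of_wbS hft hw hcomp hst, DCov_upF⟩,
    stable_DCov hft hw hcomp hst⟩

end FTP
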